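/- arXiv:math-ph/0601003 — 3 statements merged into one kernel-verified Lean document; each statement's English description precedes it below -/
import Mathlib

section
/- Let H be a complex Hilbert space, Ω a measurable space with σ-algebra 𝒜, and E : 𝒜 → L(H) a finitely additive map with E(∅) = O and 0 ≤ E(B) ≤ I for every B ∈ 𝒜. Suppose D ⊆ H is a dense subspace such that for every φ ∈ D the set function B ↦ ⟨φ|E(B)φ⟩ is σ-additive (a positive measure). Then for every φ ∈ H the set function B ↦ ⟨φ|E(B)φ⟩ is σ-additive; in particular E is a (weakly σ-additive) positive operator measure. -/
/- Common setup: trace-class formalism, projective unitary representations,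
   covariant observables, on a (possibly nonunimodular) locally compact group. -/

noncomputable section
open MeasureTheory Filter Topology ContinuousLinearMap
open scoped InnerProductSpace NNReal ENNReal Classical

namespace Paper

variable {H : Type} [NormedAddCommGroup H] [InnerProductSpace ℂ H] [CompleteSpace H]

/-- The rank-one operator `|φ⟩⟨φ| : ψ ↦ ⟨φ|ψ⟩φ` (inner product linear in the 2nd argument). -/
def rankOneSelf (φ : H) : H →L[ℂ] H := (innerSL ℂ φ).smulRight φ

/-- The trace norm of a bounded operator, with value `∞` if `T` is not trace class:
`‖T‖₁ = sup { ∑ᵢ |⟨eᵢ|T fᵢ⟩| : (eᵢ), (fᵢ) finite orthonormal families }`. -/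
def trNormENN (T : H →L[ℂ] H) : ℝ≥0∞ :=
  ⨆ (n : ℕ) (e : Fin n → H) (f : Fin n → H) (_ : Orthonormal ℂ e) (_ : Orthonormal ℂ f),
    ∑ i, (‖⟪e i, T (f i)⟫_ℂ‖₊ : ℝ≥0∞)

/-- `T` belongs to the Banach space `T(H)` of trace class operators. -/
def IsTraceClass (T : H →L[ℂ] H) : Prop := trNormENN T ≠ ∞

/-- The trace `Tr[T] = ∑ᵢ ⟨bᵢ|T bᵢ⟩` with respect to a Hilbert basis (meaningful for
trace class `T`, where it is absolutely convergent and basis independent). -/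
def traceC {ι : Type} (b : HilbertBasis ι ℂ H) (T : H →L[ℂ] H) : ℂ :=
  ∑' i, ⟪b i, T (b i)⟫_ℂ

/-- The trace of a *positive* operator as a value in `[0,∞]`. -/
def tracePosENN {ι : Type} (b : HilbertBasis ι ℂ H) (T : H →L[ℂ] H) : ℝ≥0∞ :=
  ∑' i, (‖⟪b i, T (b i)⟫_ℂ‖₊ : ℝ≥0∞)

/-- `‖Tφ‖²` for a partially defined operator `T`, with the convention that the value is `∞`
when `φ ∉ D(T)`. -/
def pNormSq (T : H →ₗ.[ℂ] H) (φ : H) : ℝ≥0∞ :=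
  if h : φ ∈ T.domain then (‖T ⟨φ, h⟩‖₊ : ℝ≥0∞) ^ 2 else ∞

/-- The squared Hilbert–Schmidt norm `‖T ∘ R‖²_HS ∈ [0,∞]` of the composition of a partially
defined operator `T` with a bounded operator `R`; it is `∞` if the composition is not everywhere
defined (in particular whenever the composition is not a Hilbert–Schmidt operator). -/
def hsNormSqComp {ι : Type} (b : HilbertBasis ι ℂ H) (T : H →ₗ.[ℂ] H) (R : H →L[ℂ] H) : ℝ≥0∞ :=
  if h : ∀ x : H, R x ∈ T.domain then ∑' i, (‖T ⟨R (b i), h (b i)⟩‖₊ : ℝ≥0∞) ^ 2 else ∞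

/-- `μ`-measurability (strong measurability) of a Banach-space-valued function: on each Borel
set of finite measure it is a `μ`-a.e. limit of a sequence of `μ`-simple functions. -/
def SimpleApproxMeasurable {α : Type} [MeasurableSpace α] (μ : Measure α) {X : Type}
    [NormedAddCommGroup X] (f : α → X) : Prop :=
  ∀ B : Set α, MeasurableSet B → μ B < ⊤ →
    ∃ s : ℕ → SimpleFunc α X,
      ∀ᵐ x ∂μ, Tendsto (fun n => s n x) atTop (𝓝 (Set.indicator B f x))

/-- `μ`-measurability (strong measurability) of a function with values in the Banach space
`T(H)` of trace class operators: on each Borel set of finite measure it is a `μ`-a.e. limit,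
in the trace norm, of a sequence of `μ`-simple operator valued functions. -/
def TraceNormMeasurable {α : Type} [MeasurableSpace α] (μ : Measure α)
    (f : α → (H →L[ℂ] H)) : Prop :=
  ∀ B : Set α, MeasurableSet B → μ B < ⊤ →
    ∃ s : ℕ → SimpleFunc α (H →L[ℂ] H),
      ∀ᵐ x ∂μ, Tendsto (fun n => trNormENN (s n x - Set.indicator B f x)) atTop (𝓝 0)

variable (H) in
/-- A projective unitary representation of `G` on `H`: a weakly Borel map into the unitary
operators with `U(e) = 1` and `U(gh) = m(g,h) U(g) U(h)` for a Borel multiplier `m` with values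
in the circle group. -/
structure ProjUnitaryRep (G : Type) [Group G] [MeasurableSpace G] : Type where
  U : G → (H →L[ℂ] H)
  unitary : ∀ g, U g ∈ unitary (H →L[ℂ] H)
  weaklyBorel : ∀ ψ φ : H, Measurable fun g => ⟪ψ, U g φ⟫_ℂ
  m : G → G → ℂ
  m_norm : ∀ g h, ‖m g h‖ = 1
  m_borel : Measurable fun p : G × G => m p.1 p.2
  map_one : U 1 = 1
  map_mul : ∀ g h, U (g * h) = m g h • (U g * U h)

variable {G : Type} [Group G] [MeasurableSpace G]

/-- `β_U(g)(S) = U(g) S U(g)*`. -/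
def ProjUnitaryRep.beta (P : ProjUnitaryRep H G) (g : G) (S : H →L[ℂ] H) : H →L[ℂ] H :=
  P.U g * S * star (P.U g)

/-- Irreducibility: only the trivial closed subspaces are invariant under all `U(g)`. -/
def ProjUnitaryRep.Irreducible (P : ProjUnitaryRep H G) : Prop :=
  ∀ V : Submodule ℂ H, IsClosed (V : Set H) → (∀ g, ∀ v ∈ V, P.U g v ∈ V) → V = ⊥ ∨ V = ⊤

/-- Square integrability w.r.t. a (Haar) measure `μ`: some nonzero matrix coefficient is
square integrable. -/
def ProjUnitaryRep.SquareIntegrable (P : ProjUnitaryRep H G) (μ : Measure G) : Prop :=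
  ∃ φ ψ : H, φ ≠ 0 ∧ ψ ≠ 0 ∧ Integrable (fun g => ‖⟪ψ, P.U g φ⟫_ℂ‖ ^ 2) μ

/-- The hypotheses pinning down `C = C_U` (the square root of the formal degree of `U`,
from the Duflo–Moore theorem) together with its inverse `Cinv = C⁻¹`: `C` is densely defined,
positive, selfadjoint and injective, `Cinv` is its (partially defined) inverse, and the
orthogonality relations `∫ |⟨ψ|U(g)φ⟩|² dμ(g) = ‖ψ‖² ‖C⁻¹φ‖²` hold (with `‖C⁻¹φ‖² = ∞` when
`φ ∉ D(C⁻¹)`). -/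
structure IsFormalDegreeSqrt (P : ProjUnitaryRep H G) (μ : Measure G)
    (C Cinv : H →ₗ.[ℂ] H) : Prop where
  dense_domain : Dense (C.domain : Set H)
  selfAdjoint : IsSelfAdjoint C
  pos : ∀ x : C.domain, 0 ≤ (⟪(x : H), C x⟫_ℂ).re
  inj : ∀ x y : C.domain, C x = C y → x = y
  inv_domain : ∀ y : H, y ∈ Cinv.domain ↔ ∃ x : C.domain, C x = y
  inv_apply : ∀ (x : C.domain) (hx : (C x : H) ∈ Cinv.domain), (Cinv ⟨C x, hx⟩ : H) = x
  duflo_moore : ∀ φ ψ : H,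
    (∫⁻ g, (‖⟪ψ, P.U g φ⟫_ℂ‖₊ : ℝ≥0∞) ^ 2 ∂μ) = (‖ψ‖₊ : ℝ≥0∞) ^ 2 * pNormSq Cinv φ

/-- `E : B(G) → L(H)` is a `β`-covariant observable: a positive normalized weakly σ-additive
operator measure with `U(g)* E(B) U(g) = E(g⁻¹B)`. -/
structure IsCovariantObservable (P : ProjUnitaryRep H G) (E : Set G → (H →L[ℂ] H)) : Prop where
  pos : ∀ B : Set G, MeasurableSet B → (E B).IsPositive
  empty : E ∅ = 0
  total : E Set.univ = 1
  sigma_additive : ∀ (φ : H) (B : ℕ → Set G), (∀ n, MeasurableSet (B n)) →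
    (Pairwise fun n k => Disjoint (B n) (B k)) →
    HasSum (fun n => ⟪φ, E (B n) φ⟫_ℂ) ⟪φ, E (⋃ n, B n) φ⟫_ℂ
  covariant : ∀ (g : G) (B : Set G), MeasurableSet B →
    star (P.U g) * E B * P.U g = E ((fun x => g * x) ⁻¹' B)

end Paper

namespace Paper

/-- The value of a finitely additive map on a finite disjoint union. -/
theorem map_biUnion_of_additive {Ω M : Type*} [MeasurableSpace Ω] [AddCommMonoid M]
    {E : Set Ω → M}
    (hadd : ∀ B1 B2 : Set Ω, MeasurableSet B1 → MeasurableSet B2 → Disjoint B1 B2 →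
      E (B1 ∪ B2) = E B1 + E B2)
    (hempty : E ∅ = 0) {ι : Type*} {B : ι → Set Ω} (hB : ∀ n, MeasurableSet (B n))
    (hdisj : Pairwise fun n k => Disjoint (B n) (B k)) (s : Finset ι) :
    E (⋃ n ∈ s, B n) = ∑ n ∈ s, E (B n) := by
  induction s using Finset.induction_on with
  | empty => simpa using hempty
  | insert a s ha ih =>
    rw [Finset.set_biUnion_insert, Finset.sum_insert ha, ← ih]
    refine hadd _ _ (hB a) (s.measurableSet_biUnion fun n _ => hB n) ?_
    refine Set.disjoint_iUnion₂_right.2 fun n hn => hdisj ?_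
    rintro rfl
    exact ha hn

/-- A positive operator bounded above by the identity is a contraction. -/
theorem norm_le_one_of_isPositive {H : Type*} [NormedAddCommGroup H] [InnerProductSpace ℂ H]
    [CompleteSpace H] {T : H →L[ℂ] H} (hT : T.IsPositive)
    (hT' : (1 - T).IsPositive) : ‖T‖ ≤ 1 := by
  have h0 : 0 ≤ T := (ContinuousLinearMap.nonneg_iff_isPositive T).2 hT
  have h1 : T ≤ 1 := (ContinuousLinearMap.le_def T 1).2 hT'
  exact (CStarAlgebra.norm_le_one_iff_of_nonneg T h0).2 h1

/-- For a contraction `T`, the quadratic form `φ ↦ ⟨φ|Tφ⟩` has a modulus of continuity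
which does not depend on `T`. -/
theorem dist_inner_apply_self_le {H : Type*} [NormedAddCommGroup H] [InnerProductSpace ℂ H]
    {T : H →L[ℂ] H} (hT : ‖T‖ ≤ 1) (φ ψ : H) :
    dist ⟪φ, T φ⟫_ℂ ⟪ψ, T ψ⟫_ℂ ≤ ‖φ - ψ‖ * (‖φ‖ + ‖ψ‖) := by
  have key : ⟪φ, T φ⟫_ℂ - ⟪ψ, T ψ⟫_ℂ = ⟪φ - ψ, T φ⟫_ℂ + ⟪ψ, T (φ - ψ)⟫_ℂ := by
    simp only [map_sub, inner_sub_left, inner_sub_right]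
    ring
  have hT1 (x : H) : ‖T x‖ ≤ ‖x‖ := by simpa using T.le_of_opNorm_le hT x
  rw [dist_eq_norm, key]
  calc ‖⟪φ - ψ, T φ⟫_ℂ + ⟪ψ, T (φ - ψ)⟫_ℂ‖
      ≤ ‖φ - ψ‖ * ‖T φ‖ + ‖ψ‖ * ‖T (φ - ψ)‖ :=
        (norm_add_le _ _).trans (add_le_add (norm_inner_le_norm _ _) (norm_inner_le_norm _ _))
    _ ≤ ‖φ - ψ‖ * ‖φ‖ + ‖ψ‖ * ‖φ - ψ‖ := by gcongr <;> exact hT1 _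
    _ = ‖φ - ψ‖ * (‖φ‖ + ‖ψ‖) := by ring

/-- If the quadratic forms of contractions `T i` converge to that of a contraction `S` on a
dense set, then they converge everywhere. -/
theorem tendsto_inner_apply_self_of_dense {H : Type*} [NormedAddCommGroup H] [InnerProductSpace ℂ H]
    {ι : Type*} {l : Filter ι} {T : ι → H →L[ℂ] H}
    {S : H →L[ℂ] H} (hT : ∀ i, ‖T i‖ ≤ 1) (hS : ‖S‖ ≤ 1) {D : Set H} (hD : Dense D)
    (h : ∀ φ ∈ D, Tendsto (fun i => ⟪φ, T i φ⟫_ℂ) l (𝓝 ⟪φ, S φ⟫_ℂ)) (φ : H) :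
    Tendsto (fun i => ⟪φ, T i φ⟫_ℂ) l (𝓝 ⟪φ, S φ⟫_ℂ) := by
  rw [Metric.tendsto_nhds]
  intro ε hε
  have hc : Continuous fun ψ : H => ‖φ - ψ‖ * (‖φ‖ + ‖ψ‖) := by fun_prop
  obtain ⟨ψ, hψ, hψD⟩ := hD.inter_open_nonempty _ (isOpen_lt hc (continuous_const (y := ε / 3)))
    ⟨φ, by simpa using hε⟩
  filter_upwards [Metric.tendsto_nhds.1 (h ψ hψD) (ε / 3) (by positivity)] with i hi
  have h1 := dist_inner_apply_self_le (hT i) φ ψ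
  have h2 := dist_inner_apply_self_le hS φ ψ
  have h3 := dist_triangle4_right ⟪φ, T i φ⟫_ℂ ⟪φ, S φ⟫_ℂ ⟪ψ, T i ψ⟫_ℂ ⟪ψ, S ψ⟫_ℂ
  have h4 : ‖φ - ψ‖ * (‖φ‖ + ‖ψ‖) < ε / 3 := hψ
  linarith

/-- a finitely additive map `E` on a σ-algebra with `E(∅) = 0` and
`0 ≤ E(B) ≤ I`, which is σ-additive in the weak sense on a dense subspace `D`, is σ-additive
weakly on all of `H`, i.e. `E` is a positive operator measure. -/
theorem statement_8
    {H : Type} [NormedAddCommGroup H] [InnerProductSpace ℂ H] [CompleteSpace H]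
    {Ω : Type} [MeasurableSpace Ω]
    (E : Set Ω → (H →L[ℂ] H))
    (hadd : ∀ B1 B2 : Set Ω, MeasurableSet B1 → MeasurableSet B2 → Disjoint B1 B2 →
      E (B1 ∪ B2) = E B1 + E B2)
    (hempty : E ∅ = 0)
    (hpos : ∀ B : Set Ω, MeasurableSet B → (E B).IsPositive)
    (hle : ∀ B : Set Ω, MeasurableSet B → (1 - E B).IsPositive)
    (D : Submodule ℂ H) (hD : Dense (D : Set H))
    (hσ : ∀ φ ∈ D, ∀ B : ℕ → Set Ω, (∀ n, MeasurableSet (B n)) →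
      (Pairwise fun n k => Disjoint (B n) (B k)) →
      HasSum (fun n => ⟪φ, E (B n) φ⟫_ℂ) ⟪φ, E (⋃ n, B n) φ⟫_ℂ) :
    ∀ φ : H, ∀ B : ℕ → Set Ω, (∀ n, MeasurableSet (B n)) →
      (Pairwise fun n k => Disjoint (B n) (B k)) →
      HasSum (fun n => ⟪φ, E (B n) φ⟫_ℂ) ⟪φ, E (⋃ n, B n) φ⟫_ℂ := by
  intro φ B hB hdisj
  have hnorm (A : Set Ω) (hA : MeasurableSet A) : ‖E A‖ ≤ 1 :=
    norm_le_one_of_isPositive (hpos A hA) (hle A hA)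
  have hsum (φ : H) (s : Finset ℕ) :
      ∑ n ∈ s, ⟪φ, E (B n) φ⟫_ℂ = ⟪φ, E (⋃ n ∈ s, B n) φ⟫_ℂ := by
    rw [map_biUnion_of_additive hadd hempty hB hdisj, _root_.sum_apply, inner_sum]
  simp only [HasSum, hsum]
  refine tendsto_inner_apply_self_of_dense
    (fun s : Finset ℕ => hnorm _ (s.measurableSet_biUnion fun n _ => hB n))
    (hnorm _ (MeasurableSet.iUnion hB)) hD (fun φ hφ => ?_) φ
  simpa only [HasSum, SummationFilter.unconditional_filter, hsum] using hσ φ hφ B hB hdisj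

end Paper
end
end

section
/- Let (Ω, 𝒜, μ) be a σ-finite measure space, H a separable complex Hilbert space, and v : Ω → T(H) a function which is Bochner integrable over every set of finite μ-measure and such that ∫_B v dμ is a positive operator for every B ∈ 𝒜 of finite μ-measure. Then v(ω) is a positive operator for μ-almost every ω ∈ Ω. -/
/- Common setup: trace-class formalism, projective unitary representations,
   covariant observables, on a (possibly nonunimodular) locally compact group. -/

noncomputable section
open MeasureTheory Filter Topology ContinuousLinearMap
open scoped InnerProductSpace NNReal ENNReal Classical

namespace Paper

theorem enorm_inner_apply_self_le {H : Type} [NormedAddCommGroup H] [InnerProductSpace ℂ H]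
    (T : H →L[ℂ] H) (φ : H) :
    ‖⟪φ, T φ⟫_ℂ‖ₑ ≤ ‖φ‖ₑ ^ 2 * trNormENN T := by
  rcases eq_or_ne φ 0 with rfl | hφ
  · simp
  have hn : (‖φ‖ : ℂ) ≠ 0 := by simpa using hφ
  let u : H := ((‖φ‖ : ℂ)⁻¹) • φ
  have hu : Orthonormal ℂ (fun _ : Fin 1 => u) := by
    refine ⟨fun _ => ?_, fun i j hij => absurd (Subsingleton.elim i j) hij⟩
    simp [u, norm_smul, hφ]
  have hsup : ‖⟪u, T u⟫_ℂ‖ₑ ≤ trNormENN T := by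
    refine le_iSup_of_le 1 (le_iSup_of_le (fun _ => u) (le_iSup_of_le (fun _ => u)
      (le_iSup_of_le hu (le_iSup_of_le hu ?_))))
    simp [enorm_eq_nnnorm]
  have hφu : φ = (‖φ‖ : ℂ) • u := by simp [u, smul_smul, hn]
  have hval : ⟪φ, T φ⟫_ℂ = (‖φ‖ : ℂ) ^ 2 * ⟪u, T u⟫_ℂ := by
    conv_lhs => rw [hφu]
    simp only [map_smul, inner_smul_left, inner_smul_right, Complex.conj_ofReal]
    ring
  have hnorm : ‖(‖φ‖ : ℂ)‖ₑ = ‖φ‖ₑ := by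
    rw [enorm_eq_iff_norm_eq]; simp
  rw [hval, enorm_mul, enorm_pow, hnorm]
  gcongr

theorem tendsto_inner_apply_self_of_trNormENN {H : Type} [NormedAddCommGroup H]
    [InnerProductSpace ℂ H] {S : ℕ → H →L[ℂ] H} {T : H →L[ℂ] H}
    (h : Tendsto (fun n => trNormENN (S n - T)) atTop (𝓝 0)) (φ : H) :
    Tendsto (fun n => ⟪φ, S n φ⟫_ℂ) atTop (𝓝 ⟪φ, T φ⟫_ℂ) := by
  rw [tendsto_iff_edist_tendsto_0]
  have hlim : Tendsto (fun n => ‖φ‖ₑ ^ 2 * trNormENN (S n - T)) atTop (𝓝 0) := by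
    simpa using ENNReal.Tendsto.const_mul h (Or.inr (by finiteness : ‖φ‖ₑ ^ 2 ≠ ∞))
  refine tendsto_of_tendsto_of_tendsto_of_le_of_le tendsto_const_nhds hlim
    (fun _ => zero_le) fun n => ?_
  simpa [edist_eq_enorm_sub, inner_sub_right] using enorm_inner_apply_self_le (S n - T) φ

theorem TraceNormMeasurable.aestronglyMeasurable_inner_apply_self {H : Type}
    [NormedAddCommGroup H] [InnerProductSpace ℂ H] {α : Type} [MeasurableSpace α]
    {μ : Measure α} {f : α → (H →L[ℂ] H)} (hf : TraceNormMeasurable μ f)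
    {B : Set α} (hB : MeasurableSet B) (hμB : μ B < ⊤) (φ : H) :
    AEStronglyMeasurable (fun x => ⟪φ, f x φ⟫_ℂ) (μ.restrict B) := by
  obtain ⟨s, hs⟩ := hf B hB hμB
  rw [← aestronglyMeasurable_indicator_iff hB]
  refine aestronglyMeasurable_of_tendsto_ae atTop (f := fun n x => ⟪φ, s n x φ⟫_ℂ)
    (fun n => ((s n).map fun T : H →L[ℂ] H => ⟪φ, T φ⟫_ℂ).aestronglyMeasurable) ?_
  filter_upwards [hs] with x hx
  convert tendsto_inner_apply_self_of_trNormENN hx φ using 2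
  by_cases hxB : x ∈ B <;> simp [hxB]

theorem TraceNormMeasurable.integrableOn_inner_apply_self {H : Type}
    [NormedAddCommGroup H] [InnerProductSpace ℂ H] {α : Type} [MeasurableSpace α]
    {μ : Measure α} {f : α → (H →L[ℂ] H)} (hf : TraceNormMeasurable μ f)
    {B : Set α} (hB : MeasurableSet B) (hμB : μ B < ⊤)
    (hint : (∫⁻ x in B, trNormENN (f x) ∂μ) < ⊤) (φ : H) :
    IntegrableOn (fun x => ⟪φ, f x φ⟫_ℂ) B μ := by
  refine ⟨hf.aestronglyMeasurable_inner_apply_self hB hμB φ, ?_⟩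
  calc ∫⁻ x in B, ‖⟪φ, f x φ⟫_ℂ‖ₑ ∂μ
      ≤ ∫⁻ x in B, ‖φ‖ₑ ^ 2 * trNormENN (f x) ∂μ :=
        lintegral_mono fun x => enorm_inner_apply_self_le (f x) φ
    _ = ‖φ‖ₑ ^ 2 * ∫⁻ x in B, trNormENN (f x) ∂μ := lintegral_const_mul' _ _ (by finiteness)
    _ < ⊤ := ENNReal.mul_lt_top (by finiteness) hint

theorem isPositive_of_dense {H : Type} [NormedAddCommGroup H] [InnerProductSpace ℂ H]
    {D : Set H} (hD : Dense D) {T : H →L[ℂ] H}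
    (h : ∀ φ ∈ D, 0 ≤ (⟪φ, T φ⟫_ℂ).re ∧ (⟪φ, T φ⟫_ℂ).im = 0) : T.IsPositive := by
  have hcont : Continuous fun φ : H => ⟪φ, T φ⟫_ℂ := by fun_prop
  have hclosed : IsClosed {φ : H | 0 ≤ (⟪φ, T φ⟫_ℂ).re ∧ (⟪φ, T φ⟫_ℂ).im = 0} :=
    (isClosed_le continuous_const (Complex.continuous_re.comp hcont)).inter
      (isClosed_eq (Complex.continuous_im.comp hcont) continuous_const)
  have hall (φ : H) : 0 ≤ (⟪φ, T φ⟫_ℂ).re ∧ (⟪φ, T φ⟫_ℂ).im = 0 :=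
    hclosed.closure_subset_iff.mpr h (hD φ)
  rw [ContinuousLinearMap.isPositive_iff_complex]
  intro φ
  obtain ⟨hre, him⟩ := hall φ
  have hre' : (⟪T φ, φ⟫_ℂ).re = (⟪φ, T φ⟫_ℂ).re := inner_re_symm (𝕜 := ℂ) _ _
  have him' : (⟪T φ, φ⟫_ℂ).im = 0 := by
    rw [← inner_conj_symm, Complex.conj_im, him, neg_zero]
  exact ⟨Complex.ext rfl him'.symm, hre.trans_eq hre'.symm⟩

/-- if `v : Ω → T(H)` is Bochner integrable (in the trace norm) over every set
of finite measure of a σ-finite measure space and all the integrals `∫_B v dμ` are positive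
operators, then `v(ω)` is positive for μ-almost every `ω`. (Bochner integrability is expressed
by strong measurability in the trace norm together with finiteness of `∫_B ‖v‖₁ dμ`, and
positivity of `∫_B v dμ` through the weak integrals.) -/
theorem statement_15
    {H : Type} [NormedAddCommGroup H] [InnerProductSpace ℂ H] [CompleteSpace H]
    [SecondCountableTopology H]
    {Ω : Type} [MeasurableSpace Ω] (μ : Measure Ω) [SigmaFinite μ]
    (v : Ω → (H →L[ℂ] H)) (hvtc : ∀ ω, IsTraceClass (v ω))
    (hmeas : TraceNormMeasurable μ v)
    (hint : ∀ B : Set Ω, MeasurableSet B → μ B < ⊤ → (∫⁻ ω in B, trNormENN (v ω) ∂μ) < ⊤)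
    (hpos : ∀ B : Set Ω, MeasurableSet B → μ B < ⊤ → ∀ φ : H,
      0 ≤ (∫ ω in B, ⟪φ, v ω φ⟫_ℂ ∂μ).re ∧ (∫ ω in B, ⟪φ, v ω φ⟫_ℂ ∂μ).im = 0) :
    ∀ᵐ ω ∂μ, (v ω).IsPositive := by
  have hio (φ : H) (B : Set Ω) (hB : MeasurableSet B) (hμB : μ B < ⊤) :
      IntegrableOn (fun ω => ⟪φ, v ω φ⟫_ℂ) B μ :=
    hmeas.integrableOn_inner_apply_self hB hμB (hint B hB hμB) φ
  have hae (φ : H) : ∀ᵐ ω ∂μ, 0 ≤ (⟪φ, v ω φ⟫_ℂ).re ∧ (⟪φ, v ω φ⟫_ℂ).im = 0 := by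
    have hre : 0 ≤ᵐ[μ] fun ω => (⟪φ, v ω φ⟫_ℂ).re := by
      refine ae_nonneg_of_forall_setIntegral_nonneg_of_sigmaFinite
        (fun B hB hμB => (hio φ B hB hμB).re) fun B hB hμB => ?_
      have h := integral_re (hio φ B hB hμB)
      exact (hpos B hB hμB φ).1.trans_eq h.symm
    have him : (fun ω => (⟪φ, v ω φ⟫_ℂ).im) =ᵐ[μ] 0 := by
      refine ae_eq_zero_of_forall_setIntegral_eq_of_sigmaFinite
        (fun B hB hμB => (hio φ B hB hμB).im) fun B hB hμB => ?_
      have h := integral_im (hio φ B hB hμB)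
      exact h.trans (hpos B hB hμB φ).2
    filter_upwards [hre, him] with ω h₁ h₂ using ⟨h₁, h₂⟩
  obtain ⟨D, hDc, hD⟩ := TopologicalSpace.exists_countable_dense H
  filter_upwards [(ae_ball_iff hDc).mpr fun φ _ => hae φ] with ω hω
  exact isPositive_of_dense hD hω

end Paper
end
end

section
/- Let H be a separable complex Hilbert space, T a closed linear operator in H, and S = Σₙ wₙ |ηₙ⟩⟨ηₙ| a positive trace class operator, where (wₙ) are nonnegative numbers and (ηₙ) is an orthonormal sequence, such that ηₙ ∈ D(T) whenever wₙ > 0 and M := Σₙ wₙ ‖Tηₙ‖² < ∞. Then √S maps H into D(T), the operator T√S (defined on all of H) is bounded with ‖T√S‖ ≤ √M, and T√S is a Hilbert–Schmidt operator with ‖T√S‖²_HS = M. -/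
/- Common setup: trace-class formalism, projective unitary representations,
   covariant observables, on a (possibly nonunimodular) locally compact group. -/

noncomputable section
open MeasureTheory Filter Topology ContinuousLinearMap
open scoped InnerProductSpace NNReal ENNReal Classical

namespace Paper

section HilbertSchmidt

variable {𝕜 E F : Type*} [RCLike 𝕜] [NormedAddCommGroup E] [InnerProductSpace 𝕜 E]
  [NormedAddCommGroup F] [InnerProductSpace 𝕜 F]

/-- Parseval's identity in `[0, ∞]`. -/
theorem _root_.HilbertBasis.tsum_enorm_inner_sq {ι : Type*} (b : HilbertBasis ι 𝕜 E) (x : E) :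
    ∑' i, ‖inner 𝕜 (b i) x‖ₑ ^ 2 = ‖x‖ₑ ^ 2 := by
  have h : HasSum (fun i => ‖inner 𝕜 (b i) x‖ ^ 2) (‖x‖ ^ 2) := by
    have h := RCLike.hasSum_re 𝕜 (b.hasSum_inner_mul_inner x x)
    rw [← norm_sq_eq_re_inner] at h
    convert! h using 2 with i
    rw [inner_mul_symm_re_eq_norm, norm_mul, norm_inner_symm x, sq]
  have key := ENNReal.ofReal_tsum_of_nonneg (fun i => sq_nonneg ‖inner 𝕜 (b i) x‖) h.summable
  simpa only [h.tsum_eq, ENNReal.ofReal_pow (norm_nonneg _), ofReal_norm] using key.symm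

/-- The Hilbert–Schmidt norms of a bounded operator and of its adjoint agree, and can be computed
in arbitrary Hilbert bases. -/
theorem tsum_enorm_apply_sq_eq_adjoint [CompleteSpace E] [CompleteSpace F] {ι κ : Type*}
    (b : HilbertBasis ι 𝕜 E) (c : HilbertBasis κ 𝕜 F) (A : E →L[𝕜] F) :
    ∑' i, ‖A (b i)‖ₑ ^ 2 = ∑' j, ‖(adjoint A) (c j)‖ₑ ^ 2 := by
  simp_rw [← c.tsum_enorm_inner_sq (A _), ← b.tsum_enorm_inner_sq (adjoint A _)]
  rw [ENNReal.tsum_comm]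
  refine tsum_congr fun j => tsum_congr fun i => ?_
  rw [adjoint_inner_right, ← ofReal_norm, ← ofReal_norm, norm_inner_symm]

/-- The Hilbert–Schmidt norm of a bounded operator does not depend on the Hilbert basis. -/
theorem tsum_enorm_apply_sq_eq [CompleteSpace E] [CompleteSpace F] {ι κ : Type*}
    (b : HilbertBasis ι 𝕜 E) (c : HilbertBasis κ 𝕜 E) (A : E →L[𝕜] F) :
    ∑' i, ‖A (b i)‖ₑ ^ 2 = ∑' j, ‖A (c j)‖ₑ ^ 2 := by
  obtain ⟨_, d, -⟩ := exists_hilbertBasis 𝕜 F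
  rw [tsum_enorm_apply_sq_eq_adjoint b d, tsum_enorm_apply_sq_eq_adjoint c d]

/-- The Hilbert–Schmidt norm of a bounded operator vanishing on the orthogonal complement of an
orthonormal family can be computed on that family. -/
theorem tsum_enorm_apply_sq_eq_of_orthonormal [CompleteSpace E] [CompleteSpace F] {ι κ : Type*}
    (b : HilbertBasis ι 𝕜 E) {v : κ → E} (hv : Orthonormal 𝕜 v) (A : E →L[𝕜] F)
    (hA : ∀ x, (∀ k, inner 𝕜 (v k) x = 0) → A x = 0) :
    ∑' i, ‖A (b i)‖ₑ ^ 2 = ∑' k, ‖A (v k)‖ₑ ^ 2 := by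
  obtain ⟨u, c, hu, hc⟩ := hv.toSubtypeRange.exists_hilbertBasis_extension
  rw [tsum_enorm_apply_sq_eq b c]
  let g : κ → u := fun k => ⟨v k, hu (Set.mem_range_self k)⟩
  have hg : Function.Injective g := fun k l h =>
    hv.linearIndependent.injective (congrArg Subtype.val h)
  have hcg : ∀ k, c (g k) = v k := fun k => by rw [hc]
  rw [← hg.tsum_eq]
  · simp_rw [hcg]
  · intro j hj
    by_contra hjg
    refine hj ?_
    have : A (c j) = 0 := hA _ fun k => by
      rw [← hcg]
      exact c.orthonormal.2 fun h => hjg ⟨k, h⟩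
    simp [this]

/-- If `v` is orthonormal and `a` is square summable, then `∑ ⟪vᵢ, x⟫ aᵢ` converges absolutely. -/
theorem _root_.Orthonormal.summable_norm_inner_smul_and_tsum_le {ι : Type*} {v : ι → E}
    (hv : Orthonormal 𝕜 v) {a : ι → F} (ha : Summable fun i => ‖a i‖ ^ 2) (x : E) :
    (Summable fun i => ‖inner 𝕜 (v i) x • a i‖) ∧
      ∑' i, ‖inner 𝕜 (v i) x • a i‖ ≤ √(∑' i, ‖a i‖ ^ 2) * ‖x‖ := by
  have h := Real.summable_and_inner_le_Lp_mul_Lq_tsum_of_nonneg Real.HolderConjugate.two_two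
    (fun i => norm_nonneg (inner 𝕜 (v i) x)) (fun i => norm_nonneg (a i))
    (by simpa using hv.inner_products_summable x) (by simpa using ha)
  simp only [← norm_smul, Real.rpow_two, ← Real.sqrt_eq_rpow] at h
  refine ⟨h.1, h.2.trans ?_⟩
  rw [mul_comm]
  gcongr
  exact Real.sqrt_le_left (norm_nonneg x) |>.mpr (hv.tsum_inner_products_le x)

end HilbertSchmidt

/-- A closed operator may be applied termwise to a convergent series. -/
theorem _root_.LinearPMap.IsClosed.mem_graph_of_hasSum {R E F ι : Type*} [CommRing R]
    [AddCommGroup E] [AddCommGroup F] [Module R E] [Module R F] [TopologicalSpace E]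
    [TopologicalSpace F] {f : E →ₗ.[R] F} (hf : f.IsClosed) {u : ι → E} {v : ι → F} {x : E} {y : F}
    (hu : HasSum u x) (hv : HasSum v y) (h : ∀ i, (u i, v i) ∈ f.graph) : (x, y) ∈ f.graph :=
  _root_.IsClosed.mem_of_tendsto hf (hu.prodMk hv)
    (.of_forall fun _ => f.graph.sum_mem fun i _ => h i)

/-- let `T` be a closed operator, `S = ∑ₙ wₙ|ηₙ⟩⟨ηₙ|` positive trace class with
`ηₙ ∈ D(T)` whenever `wₙ > 0` and `M = ∑ₙ wₙ‖Tηₙ‖² < ∞`. Then `√S` maps `H` into `D(T)`,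
`T√S` is bounded with `‖T√S‖ ≤ √M`, and `T√S` is a Hilbert–Schmidt operator with
`‖T√S‖²_HS = M`. -/
theorem statement_16
    {H : Type} [NormedAddCommGroup H] [InnerProductSpace ℂ H] [CompleteSpace H]
    [SecondCountableTopology H]
    (T : H →ₗ.[ℂ] H) (hTclosed : T.IsClosed)
    (w : ℕ → ℝ) (hw : ∀ n, 0 ≤ w n) (hwsum : Summable w)
    (η : ℕ → H) (hη : Orthonormal ℂ η)
    (hdom : ∀ n, 0 < w n → η n ∈ T.domain)
    (M : ℝ)
    (hM : HasSum (fun n => if h : η n ∈ T.domain then w n * ‖T ⟨η n, h⟩‖ ^ 2 else 0) M)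
    (sqrtS : H →L[ℂ] H)
    (hsqrtS : ∀ φ : H, sqrtS φ = ∑' n, (Real.sqrt (w n) : ℂ) • (⟪η n, φ⟫_ℂ • η n)) :
    ∃ hd : ∀ φ : H, sqrtS φ ∈ T.domain,
      (∀ φ : H, ‖T ⟨sqrtS φ, hd φ⟩‖ ≤ Real.sqrt M * ‖φ‖) ∧
      ∀ (ι : Type) (b : HilbertBasis ι ℂ H),
        HasSum (fun i => ‖T ⟨sqrtS (b i), hd (b i)⟩‖ ^ 2) M := by
  let a : ℕ → H := fun n => if h : η n ∈ T.domain then (Real.sqrt (w n) : ℂ) • T ⟨η n, h⟩ else 0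
  have ha : HasSum (fun n => ‖a n‖ ^ 2) M := by
    convert! hM using 2 with n
    by_cases h : η n ∈ T.domain
    · simp [a, h, norm_smul, mul_pow, Real.sq_sqrt (hw n)]
    · simp [a, h]
  have hη_sum : Summable fun n => ‖(Real.sqrt (w n) : ℂ) • η n‖ ^ 2 := by
    simpa [norm_smul, hη.1, Real.sq_sqrt (hw _)] using hwsum
  have haT : ∀ n, ((Real.sqrt (w n) : ℂ) • η n, a n) ∈ T.graph := fun n => by
    by_cases h : η n ∈ T.domain
    · simpa [a, h] using T.graph.smul_mem (Real.sqrt (w n) : ℂ) (T.mem_graph ⟨η n, h⟩)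
    · have hn : w n = 0 := le_antisymm (not_lt.mp fun h0 => h (hdom n h0)) (hw n)
      simp [a, h, hn]
  have hgraph : ∀ φ, (sqrtS φ, ∑' n, ⟪η n, φ⟫_ℂ • a n) ∈ T.graph := fun φ => by
    rw [hsqrtS φ]
    simp_rw [smul_comm (Real.sqrt (w _) : ℂ)]
    exact hTclosed.mem_graph_of_hasSum
      (hη.summable_norm_inner_smul_and_tsum_le hη_sum φ).1.of_norm.hasSum
      (hη.summable_norm_inner_smul_and_tsum_le ha.summable φ).1.of_norm.hasSum
      fun n => T.graph.smul_mem _ (haT n)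
  have hd : ∀ φ, sqrtS φ ∈ T.domain := fun φ => LinearPMap.mem_domain_of_mem_graph (hgraph φ)
  have hT : ∀ φ, T ⟨sqrtS φ, hd φ⟩ = ∑' n, ⟪η n, φ⟫_ℂ • a n := fun φ =>
    T.mem_graph_snd_inj (T.mem_graph ⟨sqrtS φ, hd φ⟩) (hgraph φ) rfl
  have hbound : ∀ φ, ‖T ⟨sqrtS φ, hd φ⟩‖ ≤ Real.sqrt M * ‖φ‖ := fun φ => by
    have h := hη.summable_norm_inner_smul_and_tsum_le ha.summable φ
    rw [hT, ← ha.tsum_eq]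
    exact (norm_tsum_le_tsum_norm h.1).trans h.2
  refine ⟨hd, hbound, fun ι b => ?_⟩
  let A : H →L[ℂ] H :=
    (T.toFun ∘ₗ LinearMap.codRestrict T.domain (sqrtS : H →ₗ[ℂ] H) hd).mkContinuous _ hbound
  have hA : ∀ φ, A φ = ∑' n, ⟪η n, φ⟫_ℂ • a n := hT
  have hAη : ∀ n, A (η n) = a n := fun n => by
    rw [hA, tsum_eq_single n]
    · simp [hη.1 n]
    · intro m hm
      simp [hη.2 hm]
  have hHS : ∑' i, ‖A (b i)‖ₑ ^ 2 = ENNReal.ofReal M := by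
    rw [tsum_enorm_apply_sq_eq_of_orthonormal b hη A fun x hx => by simp [hA, hx], ← ha.tsum_eq,
      ENNReal.ofReal_tsum_of_nonneg (fun n => sq_nonneg _) ha.summable]
    simp_rw [hAη, ENNReal.ofReal_pow (norm_nonneg _), ofReal_norm]
  have h := ENNReal.hasSum_toReal (hHS ▸ ENNReal.ofReal_ne_top)
  rw [← ENNReal.tsum_toReal_eq fun i => by simp, hHS,
    ENNReal.toReal_ofReal (ha.nonneg fun n => sq_nonneg _)] at h
  simp only [ENNReal.toReal_pow, toReal_enorm] at h
  exact h

end Paper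
end
end
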